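/- Let V be a complex normed vector space and B : V × V → ℂ a continuous symmetric ℂ-bilinear form. Let U ⊆ ℂ³ be open and Ω : U → V be C^∞. Suppose that for every multi-index (i,j,k) with i + j + k ≤ 3 one has B(Ω, ∂₁^i∂₂^j∂₃^k Ω) = 0 identically on U. Then on U: B(Ω, ∂₁²∂₂²∂₃ Ω) = (1/2)·( ∂₃[B(Ω, ∂₁²∂₂²Ω)] + 2·∂₂[B(Ω, ∂₁²∂₂∂₃Ω)] + 2·∂₁[B(Ω, ∂₁∂₂²∂₃Ω)] ). -/

import Mathlib

/-- Partial derivative in the first coordinate of a function on `ℂ³`. -/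
noncomputable def pd1 {V : Type*} [NormedAddCommGroup V] [NormedSpace ℂ V]
    (f : ℂ × ℂ × ℂ → V) : ℂ × ℂ × ℂ → V :=
  fun p => deriv (fun w => f (w, p.2.1, p.2.2)) p.1

/-- Partial derivative in the second coordinate of a function on `ℂ³`. -/
noncomputable def pd2 {V : Type*} [NormedAddCommGroup V] [NormedSpace ℂ V]
    (f : ℂ × ℂ × ℂ → V) : ℂ × ℂ × ℂ → V :=
  fun p => deriv (fun w => f (p.1, w, p.2.2)) p.2.1

/-- Partial derivative in the third coordinate of a function on `ℂ³`. -/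
noncomputable def pd3 {V : Type*} [NormedAddCommGroup V] [NormedSpace ℂ V]
    (f : ℂ × ℂ × ℂ → V) : ℂ × ℂ × ℂ → V :=
  fun p => deriv (fun w => f (p.1, p.2.1, w)) p.2.2

open scoped ContDiff

section LineDeriv

variable {E V : Type*} [NormedAddCommGroup E] [NormedSpace ℂ E]
  [NormedAddCommGroup V] [NormedSpace ℂ V] {U : Set E} {f g : E → V}

/-- The derivative of `f` in the constant direction `e`. -/
noncomputable def dirDeriv (e : E) (f : E → V) : E → V := fun p => lineDeriv ℂ f p e

theorem dirDeriv_eqOn_fderiv (hU : IsOpen U) (hf : ContDiffOn ℂ ω f U) (e : E) :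
    Set.EqOn (dirDeriv e f) (fun p => fderiv ℂ f p e) U := fun _ hp =>
  ((hf.contDiffAt (hU.mem_nhds hp)).differentiableAt (by simp)).lineDeriv_eq_fderiv

theorem ContDiffOn.dirDeriv (hU : IsOpen U) (hf : ContDiffOn ℂ ω f U) (e : E) :
    ContDiffOn ℂ ω (dirDeriv e f) U :=
  ((hf.fderiv_of_isOpen hU (by simp)).clm_apply contDiffOn_const).congr
    (dirDeriv_eqOn_fderiv hU hf e)

theorem Set.EqOn.dirDeriv (hU : IsOpen U) (h : Set.EqOn f g U) (e : E) :
    Set.EqOn (dirDeriv e f) (dirDeriv e g) U := fun _ hp =>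
  (h.eventuallyEq_of_mem (hU.mem_nhds hp)).lineDeriv_eq

theorem dirDeriv_comm (hU : IsOpen U) (hf : ContDiffOn ℂ ω f U) (e e' : E) :
    Set.EqOn (dirDeriv e (dirDeriv e' f)) (dirDeriv e' (dirDeriv e f)) U := by
  have key : ∀ v w : E, Set.EqOn (dirDeriv v (dirDeriv w f))
      (fun p => fderiv ℂ (fderiv ℂ f) p v w) U := by
    intro v w p hp
    have hd : DifferentiableAt ℂ (fderiv ℂ f) p :=
      ((hf.fderiv_of_isOpen hU (m := ω) (by simp)).contDiffAt
        (hU.mem_nhds hp)).differentiableAt (by simp)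
    rw [dirDeriv_eqOn_fderiv hU (hf.dirDeriv hU w) v hp]
    dsimp only
    rw [((dirDeriv_eqOn_fderiv hU hf w).eventuallyEq_of_mem (hU.mem_nhds hp)).fderiv_eq,
      fderiv_clm_apply hd (differentiableAt_const w)]
    simp
  intro p hp
  rw [key e e' hp, key e' e hp]
  exact ((hf.contDiffAt (hU.mem_nhds hp)).isSymmSndFDerivAt (by simp)).eq e e'

theorem dirDeriv_bilin (B : V →L[ℂ] V →L[ℂ] ℂ) (hU : IsOpen U) (hf : ContDiffOn ℂ ω f U)
    (hg : ContDiffOn ℂ ω g U) (e : E) {p : E} (hp : p ∈ U) :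
    dirDeriv e (fun q => B (f q) (g q)) p
      = B (dirDeriv e f p) (g p) + B (f p) (dirDeriv e g p) := by
  have hf' := (hf.contDiffAt (hU.mem_nhds hp)).differentiableAt (by simp)
  have hg' := (hg.contDiffAt (hU.mem_nhds hp)).differentiableAt (by simp)
  have h := (B.hasFDerivAt_of_bilinear hf'.hasFDerivAt hg'.hasFDerivAt).hasLineDerivAt e
  rw [dirDeriv, h.lineDeriv, dirDeriv_eqOn_fderiv hU hf e hp, dirDeriv_eqOn_fderiv hU hg e hp]
  simp [add_comm]

theorem dirDeriv_bilin_eq_of_eqOn (B : V →L[ℂ] V →L[ℂ] ℂ) (hU : IsOpen U)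
    (hf : ContDiffOn ℂ ω f U) (hg : ContDiffOn ℂ ω g U) {F : E → ℂ}
    (h : Set.EqOn (fun q => B (f q) (g q)) F U) (e : E) {p : E} (hp : p ∈ U) :
    B (dirDeriv e f p) (g p) + B (f p) (dirDeriv e g p) = dirDeriv e F p := by
  rw [← dirDeriv_bilin B hU hf hg e hp, h.dirDeriv hU e hp]

theorem dirDeriv_zero (e : E) : dirDeriv e (fun _ : E => (0 : V)) = fun _ => 0 := by
  ext p
  simp [dirDeriv, lineDeriv]

theorem dirDeriv_neg (e : E) (f : E → V) (p : E) :
    dirDeriv e (fun q => -f q) p = -dirDeriv e f p := by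
  simp [dirDeriv, lineDeriv]

end LineDeriv

section PartialDerivatives

variable {V : Type*} [NormedAddCommGroup V] [NormedSpace ℂ V]

theorem pd1_eq_dirDeriv (f : ℂ × ℂ × ℂ → V) : pd1 f = dirDeriv (1, 0, 0) f := by
  ext ⟨a, b, c⟩
  simpa [pd1, dirDeriv, lineDeriv] using
    (deriv_comp_const_add (fun w => f (w, b, c)) a 0).symm

theorem pd2_eq_dirDeriv (f : ℂ × ℂ × ℂ → V) : pd2 f = dirDeriv (0, 1, 0) f := by
  ext ⟨a, b, c⟩
  simpa [pd2, dirDeriv, lineDeriv] using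
    (deriv_comp_const_add (fun w => f (a, w, c)) b 0).symm

theorem pd3_eq_dirDeriv (f : ℂ × ℂ × ℂ → V) : pd3 f = dirDeriv (0, 0, 1) f := by
  ext ⟨a, b, c⟩
  simpa [pd3, dirDeriv, lineDeriv] using
    (deriv_comp_const_add (fun w => f (a, b, w)) c 0).symm

end PartialDerivatives

/-- Griffiths transversality relation
`W^{(2,2,1)} = (1/2)(∂₃W^{(2,2,0)} + 2∂₂W^{(2,1,1)} + 2∂₁W^{(1,2,1)})`. -/
theorem statement15 {V : Type*} [NormedAddCommGroup V] [NormedSpace ℂ V]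
    (B : V →L[ℂ] V →L[ℂ] ℂ) (hB : ∀ u v : V, B u v = B v u)
    (U : Set (ℂ × ℂ × ℂ)) (hU : IsOpen U) (Ω : ℂ × ℂ × ℂ → V) (hΩ : ContDiffOn ℂ ⊤ Ω U)
    (h0 : ∀ p ∈ U, ∀ i j k : ℕ, i + j + k ≤ 3 →
      B (Ω p) (pd1^[i] (pd2^[j] (pd3^[k] Ω)) p) = 0) :
    ∀ p ∈ U,
      B (Ω p) (pd1^[2] (pd2^[2] (pd3^[1] Ω)) p)
        = (1 / 2) * (pd3 (fun q => B (Ω q) (pd1^[2] (pd2^[2] Ω) q)) p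
            + 2 * pd2 (fun q => B (Ω q) (pd1^[2] (pd2^[1] (pd3^[1] Ω)) q)) p
            + 2 * pd1 (fun q => B (Ω q) (pd1^[1] (pd2^[2] (pd3^[1] Ω)) q)) p) := by
  have h110 := fun p hp => h0 p hp 1 1 0 (by norm_num)
  have h120 := fun p hp => h0 p hp 1 2 0 (by norm_num)
  have h210 := fun p hp => h0 p hp 2 1 0 (by norm_num)
  have h111 := fun p hp => h0 p hp 1 1 1 (by norm_num)
  clear h0
  simp only [pd1_eq_dirDeriv, pd2_eq_dirDeriv, pd3_eq_dirDeriv, Function.iterate_succ,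
    Function.iterate_zero, Function.comp_apply, id_eq] at *
  generalize ((1, 0, 0) : ℂ × ℂ × ℂ) = x at *
  generalize ((0, 1, 0) : ℂ × ℂ × ℂ) = y at *
  generalize ((0, 0, 1) : ℂ × ℂ × ℂ) = z at *
  replace hΩ : ContDiffOn ℂ ω Ω U := hΩ
  have sm : ∀ {f : ℂ × ℂ × ℂ → V}, ContDiffOn ℂ ω f U → ∀ e, ContDiffOn ℂ ω (dirDeriv e f) U :=
    fun hf e => hf.dirDeriv hU e
  have comm := fun {f : ℂ × ℂ × ℂ → V} (hf : ContDiffOn ℂ ω f U) (e e' : ℂ × ℂ × ℂ) =>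
    dirDeriv_comm hU hf e e'
  have sy := sm hΩ y
  have sz := sm hΩ z
  have sxy := sm sy x
  have syy := sm sy y
  have syz := sm sz y
  have sxxy := sm sxy x
  have sxyy := sm syy x
  have sxyz := sm syz x
  have sxxyy := sm sxyy x
  have sxxyz := sm sxyz x
  have sxyyz := sm (sm syz y) x
  have cYXY := comm sy y x
  have cYXXY : Set.EqOn (dirDeriv y (dirDeriv x (dirDeriv x (dirDeriv y Ω))))
      (dirDeriv x (dirDeriv x (dirDeriv y (dirDeriv y Ω)))) U :=
    (comm sxy y x).trans (cYXY.dirDeriv hU x)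
  have cYXYZ := comm syz y x
  have cYXXYZ : Set.EqOn (dirDeriv y (dirDeriv x (dirDeriv x (dirDeriv y (dirDeriv z Ω)))))
      (dirDeriv x (dirDeriv x (dirDeriv y (dirDeriv y (dirDeriv z Ω))))) U :=
    (comm sxyz y x).trans (cYXYZ.dirDeriv hU x)
  have cZY := comm hΩ z y
  have cZXY : Set.EqOn (dirDeriv z (dirDeriv x (dirDeriv y Ω)))
      (dirDeriv x (dirDeriv y (dirDeriv z Ω))) U :=
    (comm sy z x).trans (cZY.dirDeriv hU x)
  have cZYY : Set.EqOn (dirDeriv z (dirDeriv y (dirDeriv y Ω)))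
      (dirDeriv y (dirDeriv y (dirDeriv z Ω))) U :=
    (comm sy z y).trans (cZY.dirDeriv hU y)
  have cZXXYY : Set.EqOn (dirDeriv z (dirDeriv x (dirDeriv x (dirDeriv y (dirDeriv y Ω)))))
      (dirDeriv x (dirDeriv x (dirDeriv y (dirDeriv y (dirDeriv z Ω))))) U :=
    (comm sxyy z x).trans
      (((comm syy z x).trans (cZYY.dirDeriv hU x)).dirDeriv hU x)
  have vanish : ∀ {f g : ℂ × ℂ × ℂ → V}, ContDiffOn ℂ ω f U → ContDiffOn ℂ ω g U →
      (∀ p ∈ U, B (f p) (g p) = 0) → ∀ e, ∀ p ∈ U,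
      B (dirDeriv e f p) (g p) + B (f p) (dirDeriv e g p) = 0 := by
    intro f g hf hg h e p hp
    rw [dirDeriv_bilin_eq_of_eqOn B hU hf hg (F := fun _ => 0) h e hp, dirDeriv_zero]
  have y_xy : ∀ p ∈ U, B (dirDeriv y Ω p) (dirDeriv x (dirDeriv y Ω) p) = 0 := by
    intro p hp
    have h := vanish hΩ sxy h110 y p hp
    rwa [cYXY hp, h120 p hp, add_zero] at h
  have xy_xy : Set.EqOn
      (fun p => B (dirDeriv x (dirDeriv y Ω) p) (dirDeriv x (dirDeriv y Ω) p))
      (fun p => B (Ω p) (dirDeriv x (dirDeriv x (dirDeriv y (dirDeriv y Ω))) p)) U := by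
    intro p hp
    have h := vanish sy sxy y_xy x p hp
    have h' := vanish hΩ sxxy h210 y p hp
    rw [cYXXY hp] at h'
    dsimp only
    linear_combination h - h'
  have y_xyz : Set.EqOn
      (fun p => B (dirDeriv y Ω p) (dirDeriv x (dirDeriv y (dirDeriv z Ω)) p))
      (fun p => -B (Ω p) (dirDeriv x (dirDeriv y (dirDeriv y (dirDeriv z Ω))) p)) U := by
    intro p hp
    have h := vanish hΩ sxyz h111 y p hp
    rw [cYXYZ hp] at h
    dsimp only
    linear_combination h
  intro p hp
  have h1 := dirDeriv_bilin_eq_of_eqOn B hU sy sxyz y_xyz x hp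
  have h3 := dirDeriv_bilin_eq_of_eqOn B hU sxy sxy xy_xy z hp
  rw [dirDeriv_neg, dirDeriv_bilin B hU hΩ sxyyz x hp] at h1
  rw [dirDeriv_bilin B hU hΩ sxxyy z hp, cZXY hp, cZXXYY hp,
    hB (dirDeriv x (dirDeriv y (dirDeriv z Ω)) p)] at h3
  rw [dirDeriv_bilin B hU hΩ sxxyy z hp, dirDeriv_bilin B hU hΩ sxxyz y hp,
    dirDeriv_bilin B hU hΩ sxyyz x hp, cZXXYY hp, cYXXYZ hp]
  linear_combination (1 / 2) * h3 - h1
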